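/- Let p ≥ 2, α = p−1 and θ ≥ 0, and suppose k₀ = p−1 (i.e. p is an integer). Let 0 < σ < μ_{α,θ} and assume TMC(σ,α,θ) > σ^{p−1}/(p−1)!. Then TMC(σ,α,θ) is attained: there exists u ∈ X with ‖u‖ ≤ 1 such that TMC(σ,α,θ) = ∫₀^∞ φ_p(σ|u|^{p/(p−1)}) dλ_θ. -/

import Mathlib

open MeasureTheory Real Filter ENNReal

/-- The fractional-dimension spherical volume constant `ω_θ = 2π^((θ+1)/2)/Γ((θ+1)/2)`. -/
noncomputable def omegaW (θ : ℝ) : ℝ := 2 * Real.pi ^ ((θ + 1) / 2) / Real.Gamma ((θ + 1) / 2)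

/-- Weighted integral `∫₀^∞ f dλ_θ = ω_θ ∫₀^∞ f(r) r^θ dr` (for nonnegative integrands,
valued in `ℝ≥0∞`). -/
noncomputable def wInt (θ : ℝ) (f : ℝ → ℝ) : ℝ≥0∞ :=
  ENNReal.ofReal (omegaW θ) *
    ∫⁻ r in Set.Ioi (0 : ℝ), ENNReal.ofReal (f r) * ENNReal.ofReal (r ^ θ)

/-- The weighted Lebesgue norm `‖u‖_{L^q_θ}` (valued in `ℝ≥0∞`). -/
noncomputable def wNorm (θ q : ℝ) (u : ℝ → ℝ) : ℝ≥0∞ :=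
  (wInt θ fun r => |u r| ^ q) ^ (1 / q)

/-- Membership in the weighted Sobolev space `X = X^{1,p}_∞(α,θ)`:
`u` is locally absolutely continuous on `(0,∞)` with a.e. derivative `u'`
(expressed through the fundamental theorem of calculus on compact subintervals),
`u(r) → 0` as `r → ∞`, `‖u‖_{L^p_θ} < ∞` and `‖u'‖_{L^p_α} < ∞`. -/
structure MemX (p α θ : ℝ) (u u' : ℝ → ℝ) : Prop where
  ftc_int : ∀ a b : ℝ, 0 < a → a ≤ b → IntervalIntegrable u' MeasureTheory.volume a b
  ftc : ∀ a b : ℝ, 0 < a → a ≤ b → u b - u a = ∫ t in a..b, u' t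
  lim_zero : Filter.Tendsto u Filter.atTop (nhds 0)
  fin_u : wNorm θ p u < ⊤
  fin_u' : wNorm α p u' < ⊤

/-- Full norm on `X`: `‖u‖ = (‖u‖_{L^p_θ}^p + ‖u'‖_{L^p_α}^p)^{1/p}`. -/
noncomputable def Xnorm (p α θ : ℝ) (u u' : ℝ → ℝ) : ℝ≥0∞ :=
  ((wNorm θ p u) ^ p + (wNorm α p u') ^ p) ^ (1 / p)

/-- The truncated exponential `φ_p(t) = Σ_{j ∈ ℕ, j ≥ p-1} t^j / j!`. -/
noncomputable def phiP (p t : ℝ) : ℝ :=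
  ∑' j : ℕ, if p - 1 ≤ (j : ℝ) then t ^ j / (Nat.factorial j : ℝ) else 0

/-- The critical constant `μ_{α,θ} = (θ+1) ω_α^{1/α}`. -/
noncomputable def muC (α θ : ℝ) : ℝ := (θ + 1) * (omegaW α) ^ (1 / α)

/-- The Trudinger–Moser functional `∫₀^∞ φ_p(μ |u|^{p/(p-1)}) dλ_θ`. -/
noncomputable def TMfunc (p θ μ : ℝ) (u : ℝ → ℝ) : ℝ≥0∞ :=
  wInt θ fun r => phiP p (μ * |u r| ^ (p / (p - 1)))

/-- The subcritical Trudinger–Moser supremum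
`TMSC(μ,α,θ) = sup { ‖u‖_{L^p_θ}^{-p} ∫₀^∞ φ_p(μ|u|^{p/(p-1)}) dλ_θ : u ∈ X, u ≠ 0, ‖u'‖_{L^p_α} ≤ 1 }`. -/
noncomputable def TMSC (p α θ μ : ℝ) : ℝ≥0∞ :=
  ⨆ (u : ℝ → ℝ) (u' : ℝ → ℝ) (_ : MemX p α θ u u') (_ : u ≠ 0)
    (_ : wNorm α p u' ≤ 1), (wNorm θ p u) ^ (-p) * TMfunc p θ μ u

/-- The critical Trudinger–Moser supremum
`TMC(σ,α,θ) = sup { ∫₀^∞ φ_p(σ|u|^{p/(p-1)}) dλ_θ : u ∈ X, ‖u‖ ≤ 1 }`. -/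
noncomputable def TMC (p α θ σ : ℝ) : ℝ≥0∞ :=
  ⨆ (u : ℝ → ℝ) (u' : ℝ → ℝ) (_ : MemX p α θ u u') (_ : Xnorm p α θ u u' ≤ 1),
    TMfunc p θ σ u

/-- `k₀ = min { j ∈ ℕ : j ≥ p - 1 }`. -/
noncomputable def k0 (p : ℝ) : ℕ := sInf {j : ℕ | p - 1 ≤ (j : ℝ)}

/-- `TMC(σ,α,θ)` is attained by some `u ∈ X` with `‖u‖ ≤ 1`. -/
def TMCAttained (p α θ σ : ℝ) : Prop :=
  ∃ u u' : ℝ → ℝ, MemX p α θ u u' ∧ Xnorm p α θ u u' ≤ 1 ∧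
    TMC p α θ σ = TMfunc p θ σ u

/-- `σ_* = inf { σ ∈ (0, μ_{α,θ}) : TMC(σ,α,θ) is attained }`. -/
noncomputable def sigmaStar (p α θ : ℝ) : ℝ :=
  sInf {σ : ℝ | σ ∈ Set.Ioo 0 (muC α θ) ∧ TMCAttained p α θ σ}

theorem omegaW_pos {θ : ℝ} (hθ : 0 ≤ θ) : 0 < omegaW θ := by
  unfold omegaW
  have : 0 < Real.Gamma ((θ + 1) / 2) := Real.Gamma_pos_of_pos (by linarith)
  positivity

theorem wNorm_rpow {θ p : ℝ} (hp : 0 < p) (u : ℝ → ℝ) :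
    wNorm θ p u ^ p = wInt θ fun r => |u r| ^ p := by
  rw [wNorm, ← ENNReal.rpow_mul, one_div, inv_mul_cancel₀ hp.ne', ENNReal.rpow_one]

theorem Xnorm_le_one_iff {p α θ : ℝ} (hp : 0 < p) (u u' : ℝ → ℝ) :
    Xnorm p α θ u u' ≤ 1 ↔
      (wInt θ fun r => |u r| ^ p) + (wInt α fun r => |u' r| ^ p) ≤ 1 := by
  rw [Xnorm, wNorm_rpow hp, wNorm_rpow hp]
  have := ENNReal.rpow_le_rpow_iff (x := (wInt θ fun r => |u r| ^ p) + wInt α fun r => |u' r| ^ p)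
    (y := 1) (z := 1 / p) (by positivity)
  rwa [ENNReal.one_rpow] at this

theorem wNorm_lt_top_iff {θ p : ℝ} (hp : 0 < p) (u : ℝ → ℝ) :
    wNorm θ p u < ⊤ ↔ (wInt θ fun r => |u r| ^ p) < ⊤ := by
  rw [wNorm, ENNReal.rpow_lt_top_iff_of_pos (by positivity)]

theorem MemX.aemeasurable_deriv {p α θ : ℝ} {u u' : ℝ → ℝ} (h : MemX p α θ u u') :
    AEMeasurable u' (volume.restrict (Set.Ioi 0)) := by
  have hU : Set.Ioi (0 : ℝ) = ⋃ n : ℕ, Set.Ioc (1 / ((n : ℝ) + 1)) ((n : ℝ) + 1) := by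
    ext x
    simp only [Set.mem_Ioi, Set.mem_iUnion, Set.mem_Ioc]
    constructor
    · intro hx
      obtain ⟨n, hn⟩ := exists_nat_one_div_lt hx
      obtain ⟨m, hm⟩ := exists_nat_ge x
      refine ⟨max n m, lt_of_le_of_lt ?_ hn, hm.trans ?_⟩
      · gcongr; exact le_max_left _ _
      · have : (m : ℝ) ≤ (max n m : ℕ) := by exact_mod_cast le_max_right _ _
        linarith
    · rintro ⟨n, h1, -⟩
      exact lt_trans (by positivity) h1
  rw [hU, aemeasurable_iUnion_iff]
  intro n
  have h1 : (1 : ℝ) / ((n : ℝ) + 1) ≤ (n : ℝ) + 1 := by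
    rw [div_le_iff₀ (by positivity)]
    nlinarith [(Nat.cast_nonneg n : (0 : ℝ) ≤ n)]
  have := h.ftc_int _ _ (by positivity) h1
  rw [intervalIntegrable_iff_integrableOn_Ioc_of_le h1] at this
  exact this.aemeasurable

theorem lintegral_Ioc_ofReal_inv {r s : ℝ} (hr : 0 < r) (hrs : r ≤ s) :
    ∫⁻ t in Set.Ioc r s, ENNReal.ofReal t⁻¹ = ENNReal.ofReal (log (s / r)) := by
  rw [← integral_inv_of_pos hr (hr.trans_le hrs), intervalIntegral.integral_of_le hrs,
    ofReal_integral_eq_lintegral_ofReal]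
  · rw [← IntegrableOn, ← intervalIntegrable_iff_integrableOn_Ioc_of_le hrs]
    refine (intervalIntegral.intervalIntegrable_inv (fun x hx => ?_) continuousOn_id)
    rw [Set.uIcc_of_le hrs] at hx
    exact (hr.trans_le hx.1).ne'
  · filter_upwards [ae_restrict_mem measurableSet_Ioc] with t ht
    exact (inv_pos.2 (hr.trans ht.1)).le

/-- Local Hölder estimate for the increments of a function with `p`-integrable derivative
against the weight `t ^ (p - 1)`. -/
theorem MemX.increment_rpow_le {p θ : ℝ} {u u' : ℝ → ℝ} (hp : 2 ≤ p)
    (h : MemX p (p - 1) θ u u') {r s : ℝ} (hr : 0 < r) (hrs : r ≤ s) :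
    ENNReal.ofReal |u s - u r| ^ p ≤
      (∫⁻ t in Set.Ioc r s, ENNReal.ofReal (|u' t| ^ p) * ENNReal.ofReal (t ^ (p - 1))) *
        ENNReal.ofReal (log (s / r)) ^ (p - 1) := by
  have hp0 : 0 < p := by linarith
  have hp1 : 0 < p - 1 := by linarith
  have hpq : p.HolderConjugate (p / (p - 1)) := by
    have := Real.HolderConjugate.conjExponent (p := p) (by linarith)
    simpa [Real.conjExponent] using this
  have hsub : Set.Ioc r s ⊆ Set.Ioi 0 := fun t ht => lt_trans hr ht.1
  have hmeas : AEMeasurable u' (volume.restrict (Set.Ioc r s)) :=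
    h.aemeasurable_deriv.mono_measure (Measure.restrict_mono hsub le_rfl)
  have h1 : ENNReal.ofReal |u s - u r| ≤ ∫⁻ t in Set.Ioc r s, ‖u' t‖ₑ := by
    rw [h.ftc r s hr hrs, intervalIntegral.integral_of_le hrs, ← Real.norm_eq_abs,
      ofReal_norm]
    exact enorm_integral_le_lintegral_enorm _
  have h2 : ∫⁻ t in Set.Ioc r s, ‖u' t‖ₑ =
      ∫⁻ t in Set.Ioc r s, ((fun t => ENNReal.ofReal (|u' t| * t ^ ((p - 1) / p))) *
        (fun t => ENNReal.ofReal (t ^ (-((p - 1) / p))))) t := by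
    refine setLIntegral_congr_fun measurableSet_Ioc fun t ht => ?_
    have ht0 : 0 < t := hsub ht
    simp only [Pi.mul_apply]
    rw [← ENNReal.ofReal_mul (by positivity), mul_assoc, ← Real.rpow_add ht0, add_neg_cancel,
      Real.rpow_zero, mul_one, ← Real.norm_eq_abs, ofReal_norm]
  have h3 := ENNReal.lintegral_mul_le_Lp_mul_Lq (volume.restrict (Set.Ioc r s)) hpq
    (f := fun t => ENNReal.ofReal (|u' t| * t ^ ((p - 1) / p)))
    (g := fun t => ENNReal.ofReal (t ^ (-((p - 1) / p))))
    (by fun_prop) (by fun_prop)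
  have h4 : ∫⁻ t in Set.Ioc r s, ENNReal.ofReal (|u' t| * t ^ ((p - 1) / p)) ^ p =
      ∫⁻ t in Set.Ioc r s, ENNReal.ofReal (|u' t| ^ p) * ENNReal.ofReal (t ^ (p - 1)) := by
    refine setLIntegral_congr_fun measurableSet_Ioc fun t ht => ?_
    have ht0 : 0 < t := hsub ht
    rw [ENNReal.ofReal_rpow_of_nonneg (by positivity) hp0.le, ← ENNReal.ofReal_mul (by positivity),
      Real.mul_rpow (by positivity) (by positivity), ← Real.rpow_mul ht0.le,
      div_mul_cancel₀ _ hp0.ne']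
  have h5 : ∫⁻ t in Set.Ioc r s, ENNReal.ofReal (t ^ (-((p - 1) / p))) ^ (p / (p - 1)) =
      ENNReal.ofReal (log (s / r)) := by
    have : ∫⁻ t in Set.Ioc r s, ENNReal.ofReal (t ^ (-((p - 1) / p))) ^ (p / (p - 1)) =
        ∫⁻ t in Set.Ioc r s, ENNReal.ofReal (t⁻¹) := by
      refine setLIntegral_congr_fun measurableSet_Ioc fun t ht => ?_
      have ht0 : 0 < t := hsub ht
      rw [ENNReal.ofReal_rpow_of_nonneg (by positivity) (by positivity), ← Real.rpow_mul ht0.le]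
      congr 1
      rw [← Real.rpow_neg_one]
      congr 1
      field_simp
    rw [this, lintegral_Ioc_ofReal_inv hr hrs]
  rw [h4, h5] at h3
  calc ENNReal.ofReal |u s - u r| ^ p
      ≤ ((∫⁻ t in Set.Ioc r s, ENNReal.ofReal (|u' t| ^ p) * ENNReal.ofReal (t ^ (p - 1))) ^ (1 / p)
        * ENNReal.ofReal (log (s / r)) ^ (1 / (p / (p - 1)))) ^ p := by
        gcongr
        exact h1.trans (h2.le.trans h3)
    _ = _ := by
        rw [ENNReal.mul_rpow_of_nonneg _ _ hp0.le, ← ENNReal.rpow_mul, ← ENNReal.rpow_mul]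
        congr 2
        · rw [one_div, inv_mul_cancel₀ hp0.ne', ENNReal.rpow_one]
        · field_simp

theorem lintegral_le_of_wInt_le {θ : ℝ} (hθ : 0 ≤ θ) {f : ℝ → ℝ} {c : ℝ}
    (h : wInt θ f ≤ ENNReal.ofReal c) :
    ∫⁻ r in Set.Ioi (0 : ℝ), ENNReal.ofReal (f r) * ENNReal.ofReal (r ^ θ) ≤
      ENNReal.ofReal ((omegaW θ)⁻¹ * c) := by
  have hω := omegaW_pos hθ
  rw [wInt] at h
  rw [ENNReal.ofReal_mul (by positivity), ENNReal.ofReal_inv_of_pos hω]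
  rwa [← ENNReal.mul_le_iff_le_inv (by simpa using hω) ENNReal.ofReal_ne_top]

/-- Logarithmic modulus of continuity, uniform over the unit ball of the gradient seminorm. -/
theorem MemX.abs_sub_le {p θ : ℝ} {u u' : ℝ → ℝ} (hp : 2 ≤ p)
    (h : MemX p (p - 1) θ u u') (h1 : (wInt (p - 1) fun r => |u' r| ^ p) ≤ 1)
    {r s : ℝ} (hr : 0 < r) (hrs : r ≤ s) :
    |u s - u r| ≤ omegaW (p - 1) ^ (-(1 / p)) * log (s / r) ^ ((p - 1) / p) := by
  have hp0 : 0 < p := by linarith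
  have hω : 0 < omegaW (p - 1) := omegaW_pos (by linarith)
  have hlog : 0 ≤ log (s / r) := Real.log_nonneg ((one_le_div hr).2 hrs)
  have hE := lintegral_le_of_wInt_le (θ := p - 1) (by linarith) (c := 1) (h1.trans (by simp))
  have hsub : Set.Ioc r s ⊆ Set.Ioi 0 := fun t ht => lt_trans hr ht.1
  have h2 := h.increment_rpow_le hp hr hrs
  have h3 : ENNReal.ofReal (|u s - u r| ^ p) ≤
      ENNReal.ofReal ((omegaW (p - 1))⁻¹ * log (s / r) ^ (p - 1)) := by
    rw [← ENNReal.ofReal_rpow_of_nonneg (abs_nonneg _) hp0.le]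
    refine h2.trans ?_
    rw [ENNReal.ofReal_mul (by positivity), ENNReal.ofReal_rpow_of_nonneg hlog (by linarith)]
    gcongr
    refine (lintegral_mono_set hsub).trans (hE.trans ?_)
    rw [mul_one]
  rw [ENNReal.ofReal_le_ofReal_iff (by positivity)] at h3
  have h4 := Real.rpow_le_rpow (by positivity) h3 (by positivity : 0 ≤ 1 / p)
  rw [← Real.rpow_mul (abs_nonneg _), mul_one_div_cancel hp0.ne', Real.rpow_one,
    Real.mul_rpow (by positivity) (by positivity), ← Real.rpow_mul hlog, ← Real.rpow_neg_one,
    ← Real.rpow_mul hω.le] at h4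
  convert h4 using 3 <;> ring

/-- Averaging over multiplicative windows against the Haar measure `dr / r`. -/
theorem lintegral_window {g : ℝ → ℝ≥0∞} (hg : AEMeasurable g (volume.restrict (Set.Ioi 0)))
    {q : ℝ} (hq : 1 < q) :
    ∫⁻ r in Set.Ioi (0 : ℝ), (∫⁻ t in Set.Ioc r (r * q), g t) * ENNReal.ofReal r⁻¹ =
      ENNReal.ofReal (log q) * ∫⁻ t in Set.Ioi (0 : ℝ), g t := by
  have hq0 : 0 < q := by linarith
  set S : Set (ℝ × ℝ) := {z | z.1 < z.2 ∧ z.2 ≤ z.1 * q} with hS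
  have hSm : MeasurableSet S := by
    apply MeasurableSet.inter
    · exact measurableSet_lt measurable_fst measurable_snd
    · exact measurableSet_le measurable_snd (measurable_fst.mul_const q)
  have hF : AEMeasurable (fun z : ℝ × ℝ => S.indicator
      (fun z => g z.2 * ENNReal.ofReal z.1⁻¹) z)
      ((volume.restrict (Set.Ioi 0)).prod (volume.restrict (Set.Ioi 0))) := by
    apply AEMeasurable.indicator _ hSm
    exact (hg.comp_snd).mul (by fun_prop)
  have hL : ∀ r ∈ Set.Ioi (0 : ℝ), (∫⁻ t in Set.Ioc r (r * q), g t) * ENNReal.ofReal r⁻¹ =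
      ∫⁻ t in Set.Ioi (0 : ℝ), S.indicator (fun z => g z.2 * ENNReal.ofReal z.1⁻¹) (r, t) := by
    intro r hr
    have hsub : Set.Ioc r (r * q) ⊆ Set.Ioi 0 := fun t ht => lt_trans hr ht.1
    rw [← lintegral_mul_const' _ _ ENNReal.ofReal_ne_top,
      ← Set.inter_eq_self_of_subset_left hsub,
      ← Measure.restrict_restrict measurableSet_Ioc, ← lintegral_indicator measurableSet_Ioc]
    rfl
  have hR : ∀ t ∈ Set.Ioi (0 : ℝ),
      ∫⁻ r in Set.Ioi (0 : ℝ), S.indicator (fun z => g z.2 * ENNReal.ofReal z.1⁻¹) (r, t) =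
      ENNReal.ofReal (log q) * g t := by
    intro t ht
    have ht0 : 0 < t := ht
    have htq : t / q ≤ t := div_le_self ht0.le hq.le
    have hsub : Set.Ico (t / q) t ⊆ Set.Ioi 0 := fun r hr => lt_of_lt_of_le (by positivity) hr.1
    have : log q = log (t / (t / q)) := by congr 1; field_simp
    rw [this, ← lintegral_Ioc_ofReal_inv (by positivity) htq, mul_comm,
      ← restrict_Ico_eq_restrict_Ioc, ← lintegral_const_mul _ (by fun_prop),
      ← Set.inter_eq_self_of_subset_left hsub,
      ← Measure.restrict_restrict measurableSet_Ico, ← lintegral_indicator measurableSet_Ico]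
    congr 1
    ext r
    simp only [Set.indicator, hS, Set.mem_Ico, Set.mem_ofPred_eq, div_le_iff₀ hq0]
    simp only [and_comm]
  rw [setLIntegral_congr_fun measurableSet_Ioi hL, lintegral_lintegral_swap hF,
    setLIntegral_congr_fun measurableSet_Ioi hR, lintegral_const_mul' _ _ ENNReal.ofReal_ne_top]

theorem MemX.lintegral_increment_le {p θ : ℝ} {u u' : ℝ → ℝ} (hp : 2 ≤ p)
    (h : MemX p (p - 1) θ u u') {q : ℝ} (hq : 1 < q) :
    ∫⁻ r in Set.Ioi (0 : ℝ), ENNReal.ofReal |u (r * q) - u r| ^ p * ENNReal.ofReal r⁻¹ ≤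
      ENNReal.ofReal (log q) ^ p * ∫⁻ t in Set.Ioi (0 : ℝ),
        ENNReal.ofReal (|u' t| ^ p) * ENNReal.ofReal (t ^ (p - 1)) := by
  have hlog : 0 < log q := Real.log_pos hq
  set g : ℝ → ℝ≥0∞ := fun t => ENNReal.ofReal (|u' t| ^ p) * ENNReal.ofReal (t ^ (p - 1)) with hgdef
  have hg : AEMeasurable g (volume.restrict (Set.Ioi 0)) := by
    have := h.aemeasurable_deriv
    fun_prop
  have h1 : ∀ r ∈ Set.Ioi (0 : ℝ),
      ENNReal.ofReal |u (r * q) - u r| ^ p * ENNReal.ofReal r⁻¹ ≤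
      ENNReal.ofReal (log q) ^ (p - 1) *
        ((∫⁻ t in Set.Ioc r (r * q), g t) * ENNReal.ofReal r⁻¹) := by
    intro r hr
    have hr0 : 0 < r := hr
    have := h.increment_rpow_le hp hr0 (le_mul_of_one_le_right hr0.le hq.le)
    rw [mul_div_cancel_left₀ _ hr0.ne'] at this
    rw [← mul_assoc]
    exact mul_le_mul' (this.trans_eq (mul_comm _ _)) le_rfl
  calc _ ≤ ∫⁻ r in Set.Ioi (0 : ℝ), ENNReal.ofReal (log q) ^ (p - 1) *
        ((∫⁻ t in Set.Ioc r (r * q), g t) * ENNReal.ofReal r⁻¹) :=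
        setLIntegral_mono' measurableSet_Ioi h1
    _ = _ := by
        rw [lintegral_const_mul' _ _ (by simp [hlog]), lintegral_window hg hq, ← mul_assoc]
        congr 1
        conv_lhs => rw [← ENNReal.rpow_one (ENNReal.ofReal (log q)), ← ENNReal.rpow_mul, one_mul]
        rw [← ENNReal.rpow_add _ _ (by simpa using hlog) ENNReal.ofReal_ne_top, sub_add_cancel]

theorem continuousOn_Ioi_of_continuousOn_Icc {f : ℝ → ℝ}
    (h : ∀ a b : ℝ, 0 < a → a ≤ b → ContinuousOn f (Set.Icc a b)) :
    ContinuousOn f (Set.Ioi 0) := by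
  intro x hx
  have hx0 : 0 < x := hx
  have := h (x / 2) (2 * x) (by positivity) (by linarith)
  exact (this.continuousAt (Icc_mem_nhds (by linarith) (by linarith))).continuousWithinAt

theorem MemX.continuousOn {p α θ : ℝ} {u u' : ℝ → ℝ} (h : MemX p α θ u u') :
    ContinuousOn u (Set.Ioi 0) := by
  refine continuousOn_Ioi_of_continuousOn_Icc fun a b ha hab => ?_
  have h1 := ((h.ftc_int a b ha hab).absolutelyContinuousOnInterval_intervalIntegral
    (c := a) (by simp)).continuousOn
  rw [Set.uIcc_of_le hab] at h1
  refine (continuousOn_const.add h1 : ContinuousOn (fun x => u a + _) _).congr fun x hx => ?_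
  have := h.ftc a x ha hx.1
  simp only [Pi.add_apply]
  linarith

theorem aemeasurable_comp_mul {f : ℝ → ℝ} (hf : ContinuousOn f (Set.Ioi 0)) {q : ℝ} (hq : 0 < q) :
    AEMeasurable (fun r => f (r * q)) (volume.restrict (Set.Ioi 0)) := by
  refine ContinuousOn.aemeasurable ?_ measurableSet_Ioi
  exact hf.comp (by fun_prop) fun r hr => mul_pos hr hq

theorem abs_le_add_rpow_div {p K x : ℝ} (hp : 2 ≤ p) (hK : 0 < K) :
    |x| ≤ K + |x| ^ p / K ^ (p - 1) := by
  rcases le_or_gt |x| K with h | h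
  · have : 0 ≤ |x| ^ p / K ^ (p - 1) := by positivity
    linarith
  · have hx : 0 < |x| := hK.trans h
    have h1 : K ^ (p - 1) ≤ |x| ^ (p - 1) := Real.rpow_le_rpow hK.le h.le (by linarith)
    have h2 : |x| ≤ |x| ^ p / K ^ (p - 1) := by
      rw [le_div_iff₀ (by positivity)]
      calc |x| * K ^ (p - 1) ≤ |x| * |x| ^ (p - 1) := by gcongr
        _ = |x| ^ (1 + (p - 1)) := by rw [Real.rpow_add hx, Real.rpow_one]
        _ = |x| ^ p := by ring_nf
    linarith

theorem MemX.dist_le_lintegral {p α θ : ℝ} {u u' : ℝ → ℝ} (h : MemX p α θ u u') {x y : ℝ}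
    (hx : 0 < x) (hy : 0 < y) :
    ENNReal.ofReal (dist (u x) (u y)) ≤ ∫⁻ t in Set.uIoc x y, ENNReal.ofReal |u' t| := by
  wlog hxy : x ≤ y generalizing x y
  · rw [dist_comm, Set.uIoc_comm]
    exact this hy hx (le_of_not_ge hxy)
  rw [dist_comm, Real.dist_eq, h.ftc x y hx hxy, intervalIntegral.integral_of_le hxy,
    Set.uIoc_of_le hxy, ← Real.norm_eq_abs, ofReal_norm]
  simp_rw [← Real.norm_eq_abs, ofReal_norm]
  exact enorm_integral_le_lintegral_enorm _

theorem MemX.sum_dist_le {p θ : ℝ} {u u' : ℝ → ℝ} (hp : 2 ≤ p)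
    (h : MemX p (p - 1) θ u u') (h1 : (wInt (p - 1) fun r => |u' r| ^ p) ≤ 1)
    {a b K : ℝ} (ha : 0 < a) (hab : a ≤ b) (hK : 0 < K) {E : ℕ × (ℕ → ℝ × ℝ)}
    (hE : E ∈ AbsolutelyContinuousOnInterval.disjWithin a b) :
    ∑ i ∈ Finset.range E.1, dist (u (E.2 i).1) (u (E.2 i).2) ≤
      K * ∑ i ∈ Finset.range E.1, dist (E.2 i).1 (E.2 i).2 +
        (omegaW (p - 1))⁻¹ / (K * a) ^ (p - 1) := by
  have hω : 0 < omegaW (p - 1) := omegaW_pos (by linarith)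
  have hen := lintegral_le_of_wInt_le (θ := p - 1) (by linarith) (c := 1) (h1.trans (by simp))
  rw [mul_one] at hen
  set g : ℝ → ℝ≥0∞ := fun t => ENNReal.ofReal (|u' t| ^ p) * ENNReal.ofReal (t ^ (p - 1)) with hgdef
  set c : ℝ := ((K * a) ^ (p - 1))⁻¹ with hc
  have hc0 : 0 < c := by positivity
  have hmem := hE.1
  rw [Set.uIcc_of_le hab] at hmem
  have hpt : ∀ t, a ≤ t → ENNReal.ofReal |u' t| ≤ ENNReal.ofReal K + ENNReal.ofReal c * g t := by
    intro t hat
    have ht : 0 < t := ha.trans_le hat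
    rw [hgdef]
    simp only
    rw [← ENNReal.ofReal_mul (by positivity), ← ENNReal.ofReal_mul (by positivity),
      ← ENNReal.ofReal_add (by positivity) (by positivity)]
    refine ENNReal.ofReal_le_ofReal ((abs_le_add_rpow_div hp hK).trans ?_)
    have h2 : a ^ (p - 1) ≤ t ^ (p - 1) := Real.rpow_le_rpow ha.le hat (by linarith)
    have h3 : |u' t| ^ p / K ^ (p - 1) = c * (|u' t| ^ p * a ^ (p - 1)) := by
      rw [hc, Real.mul_rpow hK.le ha.le]
      field_simp
    rw [h3]
    gcongr
  have hmain : ∀ i ∈ Finset.range E.1, ENNReal.ofReal (dist (u (E.2 i).1) (u (E.2 i).2)) ≤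
      ENNReal.ofReal K * ENNReal.ofReal (dist (E.2 i).1 (E.2 i).2) +
        ENNReal.ofReal c * ∫⁻ t in Set.uIoc (E.2 i).1 (E.2 i).2, g t := by
    intro i hi
    obtain ⟨hx, hy⟩ := hmem i hi
    refine (h.dist_le_lintegral (ha.trans_le hx.1) (ha.trans_le hy.1)).trans ?_
    calc ∫⁻ t in Set.uIoc (E.2 i).1 (E.2 i).2, ENNReal.ofReal |u' t|
        ≤ ∫⁻ t in Set.uIoc (E.2 i).1 (E.2 i).2, (ENNReal.ofReal K + ENNReal.ofReal c * g t) := by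
          refine setLIntegral_mono' measurableSet_uIoc fun t ht => hpt t ?_
          exact (le_min hx.1 hy.1).trans ht.1.le
      _ = _ := by
          rw [lintegral_add_left measurable_const, lintegral_const_mul' _ _ ENNReal.ofReal_ne_top]
          congr 1
          rw [lintegral_const, Measure.restrict_apply_univ, Set.uIoc, Real.volume_Ioc,
            max_sub_min_eq_abs, abs_sub_comm, Real.dist_eq, abs_sub_comm]
  have hsum : ∑ i ∈ Finset.range E.1, ∫⁻ t in Set.uIoc (E.2 i).1 (E.2 i).2, g t ≤
      ENNReal.ofReal (omegaW (p - 1))⁻¹ := by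
    rw [← lintegral_biUnion_finset hE.2 (fun i _ => measurableSet_uIoc)]
    refine le_trans (lintegral_mono_set ?_) hen
    refine (AbsolutelyContinuousOnInterval.biUnion_uIoc_subset_of_mem_disjWithin
      (n := E.1) (I := E.2) hE).trans ?_
    rw [Set.uIoc_of_le hab]
    exact fun t ht => ha.trans ht.1
  have hfin : ENNReal.ofReal (∑ i ∈ Finset.range E.1, dist (u (E.2 i).1) (u (E.2 i).2)) ≤
      ENNReal.ofReal (K * ∑ i ∈ Finset.range E.1, dist (E.2 i).1 (E.2 i).2 +
        (omegaW (p - 1))⁻¹ / (K * a) ^ (p - 1)) := by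
    rw [ENNReal.ofReal_sum_of_nonneg (fun _ _ => dist_nonneg)]
    refine (Finset.sum_le_sum hmain).trans ?_
    rw [Finset.sum_add_distrib, ← Finset.mul_sum, ← Finset.mul_sum,
      ← ENNReal.ofReal_sum_of_nonneg (fun _ _ => dist_nonneg), ← ENNReal.ofReal_mul hK.le,
      ENNReal.ofReal_add (by positivity) (by positivity), div_eq_inv_mul,
      ← hc, ENNReal.ofReal_mul hc0.le]
    gcongr
  rwa [ENNReal.ofReal_le_ofReal_iff (by positivity)] at hfin

theorem absolutelyContinuousOnInterval_of_tendsto {p θ : ℝ} {u u' : ℕ → ℝ → ℝ} {v : ℝ → ℝ}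
    (hp : 2 ≤ p) (h : ∀ k, MemX p (p - 1) θ (u k) (u' k))
    (h1 : ∀ k, (wInt (p - 1) fun r => |u' k r| ^ p) ≤ 1)
    (hv : ∀ r, 0 < r → Tendsto (fun k => u k r) atTop (nhds (v r)))
    {a b : ℝ} (ha : 0 < a) (hab : a ≤ b) : AbsolutelyContinuousOnInterval v a b := by
  have hω : 0 < omegaW (p - 1) := omegaW_pos (by linarith)
  rw [absolutelyContinuousOnInterval_iff]
  intro ε hε
  have htend : Tendsto (fun K : ℝ => (omegaW (p - 1))⁻¹ / (K * a) ^ (p - 1)) atTop (nhds 0) := by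
    refine Tendsto.div_atTop tendsto_const_nhds ?_
    exact (tendsto_rpow_atTop (by linarith)).comp (tendsto_id.atTop_mul_const ha)
  obtain ⟨K, hK1, hK0⟩ := ((htend.eventually (gt_mem_nhds (half_pos hε))).and
    (eventually_gt_atTop 0)).exists
  refine ⟨ε / (2 * K), by positivity, fun E hE hd => ?_⟩
  have hmem := hE.1
  rw [Set.uIcc_of_le hab] at hmem
  have hlim : Tendsto (fun k => ∑ i ∈ Finset.range E.1, dist (u k (E.2 i).1) (u k (E.2 i).2)) atTop
      (nhds (∑ i ∈ Finset.range E.1, dist (v (E.2 i).1) (v (E.2 i).2))) := by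
    refine tendsto_finsetSum _ fun i hi => ?_
    exact (hv _ (ha.trans_le (hmem i hi).1.1)).dist (hv _ (ha.trans_le (hmem i hi).2.1))
  have := le_of_tendsto' hlim fun k => (h k).sum_dist_le hp (h1 k) ha hab hK0 hE
  rw [lt_div_iff₀ (by positivity)] at hd
  nlinarith

theorem lintegral_increment_le_liminf {p θ : ℝ} {u u' : ℕ → ℝ → ℝ} {v : ℝ → ℝ}
    (hp : 2 ≤ p) (h : ∀ k, MemX p (p - 1) θ (u k) (u' k))
    (hv : ∀ r, 0 < r → Tendsto (fun k => u k r) atTop (nhds (v r))) {q : ℝ} (hq : 1 < q) :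
    ∫⁻ r in Set.Ioi (0 : ℝ), ENNReal.ofReal |v (r * q) - v r| ^ p * ENNReal.ofReal r⁻¹ ≤
      ENNReal.ofReal (log q) ^ p * liminf (fun k => ∫⁻ t in Set.Ioi (0 : ℝ),
        ENNReal.ofReal (|u' k t| ^ p) * ENNReal.ofReal (t ^ (p - 1))) atTop := by
  have hq0 : 0 < q := by linarith
  have hlim : ∀ r ∈ Set.Ioi (0 : ℝ),
      ENNReal.ofReal |v (r * q) - v r| ^ p * ENNReal.ofReal r⁻¹ =
      liminf (fun k => ENNReal.ofReal |u k (r * q) - u k r| ^ p * ENNReal.ofReal r⁻¹) atTop := by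
    intro r hr
    symm
    apply Tendsto.liminf_eq
    apply ENNReal.Tendsto.mul_const _ (Or.inr ENNReal.ofReal_ne_top)
    exact (ENNReal.continuous_rpow_const.tendsto _).comp
      (ENNReal.tendsto_ofReal ((hv _ (mul_pos hr hq0)).sub (hv r hr)).abs)
  rw [setLIntegral_congr_fun measurableSet_Ioi hlim]
  refine (lintegral_liminf_le' fun k => ?_).trans ?_
  · have h1 := aemeasurable_comp_mul (h k).continuousOn hq0
    have h2 := (h k).continuousOn.aemeasurable (μ := volume) measurableSet_Ioi
    exact ((continuous_abs.measurable.comp_aemeasurable (h1.sub h2)).ennreal_ofReal.pow_const p).mul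
      (by fun_prop)
  · have hc : ENNReal.ofReal (log q) ^ p ≠ ⊤ := by
      simp [Real.log_pos hq]
    have hmono : Monotone fun x : ℝ≥0∞ => ENNReal.ofReal (log q) ^ p * x :=
      fun x y hxy => mul_le_mul_right hxy _
    rw [hmono.map_liminf_of_continuousAt _ (ENNReal.continuous_const_mul hc).continuousAt]
    exact liminf_le_liminf (Eventually.of_forall fun k => (h k).lintegral_increment_le hp hq)

/-- Weak lower semicontinuity of the gradient energy along pointwise convergent sequences. -/
theorem lintegral_deriv_rpow_le_liminf {p θ : ℝ} {u u' : ℕ → ℝ → ℝ} {v : ℝ → ℝ}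
    (hp : 2 ≤ p) (h : ∀ k, MemX p (p - 1) θ (u k) (u' k))
    (hv : ∀ r, 0 < r → Tendsto (fun k => u k r) atTop (nhds (v r)))
    (hvc : ContinuousOn v (Set.Ioi 0))
    (hvd : ∀ᵐ r ∂volume.restrict (Set.Ioi (0 : ℝ)), DifferentiableAt ℝ v r) :
    ∫⁻ r in Set.Ioi (0 : ℝ), ENNReal.ofReal (|deriv v r| ^ p) * ENNReal.ofReal (r ^ (p - 1)) ≤
      liminf (fun k => ∫⁻ t in Set.Ioi (0 : ℝ),
        ENNReal.ofReal (|u' k t| ^ p) * ENNReal.ofReal (t ^ (p - 1))) atTop := by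
  have hp0 : 0 < p := by linarith
  set B := liminf (fun k => ∫⁻ t in Set.Ioi (0 : ℝ),
        ENNReal.ofReal (|u' k t| ^ p) * ENNReal.ofReal (t ^ (p - 1))) atTop with hB
  let d : ℕ → ℝ := fun m => 1 / ((m : ℝ) + 1)
  have hd : ∀ m, 0 < d m := fun m => by positivity
  have hd0 : Tendsto d atTop (nhdsWithin 0 (Set.Ioi 0)) := by
    rw [tendsto_nhdsWithin_iff]
    exact ⟨tendsto_one_div_add_atTop_nhds_zero_nat, Eventually.of_forall hd⟩
  have hbound : ∀ m, ∫⁻ r in Set.Ioi (0 : ℝ), (ENNReal.ofReal (d m) ^ p)⁻¹ *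
      (ENNReal.ofReal |v (r * (1 + d m)) - v r| ^ p * ENNReal.ofReal r⁻¹) ≤ B := by
    intro m
    have hdp : ENNReal.ofReal (d m) ^ p ≠ 0 := by
      simp [ENNReal.rpow_eq_zero_iff, hp0.not_gt, hd m]
    have hdt : ENNReal.ofReal (d m) ^ p ≠ ⊤ := by simp [hp0.le]
    rw [lintegral_const_mul' _ _ (by simpa using hdp), ENNReal.inv_mul_le_iff hdp hdt]
    refine (lintegral_increment_le_liminf hp h hv (by linarith [hd m])).trans ?_
    gcongr
    have := Real.log_le_sub_one_of_pos (x := 1 + d m) (by linarith [hd m])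
    linarith
  have hlim : ∀ᵐ r ∂volume.restrict (Set.Ioi (0 : ℝ)),
      ENNReal.ofReal (|deriv v r| ^ p) * ENNReal.ofReal (r ^ (p - 1)) =
      liminf (fun m => (ENNReal.ofReal (d m) ^ p)⁻¹ *
        (ENNReal.ofReal |v (r * (1 + d m)) - v r| ^ p * ENNReal.ofReal r⁻¹)) atTop := by
    filter_upwards [hvd, ae_restrict_mem measurableSet_Ioi] with r hr hr0
    have hr0 : 0 < r := hr0
    symm
    apply Tendsto.liminf_eq
    have h1 : HasDerivAt (fun s => v (r * s)) (deriv v r * r) 1 := by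
      have := HasDerivAt.comp (h₂ := v) (h := fun s => r * s) (h' := r) (h₂' := deriv v r) 1
        (by simpa using hr.hasDerivAt) (by simpa using (hasDerivAt_id (1 : ℝ)).const_mul r)
      exact this
    have h2 := h1.tendsto_slope_zero_right.comp hd0
    have h3 := (((h2.abs).rpow_const (p := p) (Or.inr hp0.le)).mul_const r⁻¹)
    have h4 := ENNReal.tendsto_ofReal h3
    convert h4 using 1
    · ext m
      simp only [Function.comp, smul_eq_mul, mul_one]
      have hdm := hd m
      rw [ENNReal.ofReal_rpow_of_nonneg hdm.le hp0.le, ← ENNReal.ofReal_inv_of_pos (by positivity),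
        ENNReal.ofReal_rpow_of_nonneg (abs_nonneg _) hp0.le, ← ENNReal.ofReal_mul (by positivity),
        ← ENNReal.ofReal_mul (by positivity), abs_mul, Real.mul_rpow (by positivity) (by positivity),
        abs_of_pos (inv_pos.2 hdm), Real.inv_rpow hdm.le, mul_assoc]
    · rw [← ENNReal.ofReal_mul (by positivity), abs_mul, Real.mul_rpow (by positivity) (by positivity),
        abs_of_pos hr0, Real.rpow_sub_one hr0.ne', mul_assoc, div_eq_mul_inv]
  rw [lintegral_congr_ae hlim]
  refine (lintegral_liminf_le' fun m => ?_).trans ?_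
  · have h1 := aemeasurable_comp_mul hvc (q := 1 + d m) (by linarith [hd m])
    have h2 := hvc.aemeasurable (μ := volume) measurableSet_Ioi
    exact AEMeasurable.const_mul
      (((continuous_abs.measurable.comp_aemeasurable (h1.sub h2)).ennreal_ofReal.pow_const p).mul
        (by fun_prop)) _
  · refine (liminf_le_liminf (Eventually.of_forall hbound)).trans ?_
    simp

/-- Diagonal extraction for locally equicontinuous, pointwise bounded sequences on `(0, ∞)`,
together with convergence of an auxiliary sequence in `[0, ∞]`. -/
theorem exists_subseq_tendsto_pointwise {u : ℕ → ℝ → ℝ} {a : ℕ → ℝ≥0∞}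
    (hbdd : ∀ r, 0 < r → ∃ M, ∀ k, |u k r| ≤ M)
    (hequi : ∀ r, 0 < r → ∀ ε > 0, ∃ δ > 0, ∀ s, r ≤ s → s < r + δ → ∀ k, |u k s - u k r| ≤ ε) :
    ∃ (φ : ℕ → ℕ) (v : ℝ → ℝ) (L : ℝ≥0∞), StrictMono φ ∧
      (∀ r, 0 < r → Tendsto (fun k => u (φ k) r) atTop (nhds (v r))) ∧
      Tendsto (fun k => a (φ k)) atTop (nhds L) := by
  choose! M hM using hbdd
  let I := {q : ℚ // 0 < (q : ℝ)}
  let K : Set ((I → ℝ) × ℝ≥0∞) :=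
    (Set.univ.pi fun q : I => Set.Icc (-M (q.1 : ℝ)) (M (q.1 : ℝ))) ×ˢ Set.univ
  have hK : IsCompact K := (isCompact_univ_pi fun q => isCompact_Icc).prod isCompact_univ
  obtain ⟨z, -, φ, hφ, hz⟩ := hK.tendsto_subseq
    (x := fun k => ((fun q : I => u k (q.1 : ℝ)), a k)) (fun k => by
      refine ⟨?_, trivial⟩
      intro q _
      exact abs_le.1 (hM _ q.2 k))
  rw [nhds_prod_eq, tendsto_prod_iff'] at hz
  obtain ⟨hz1, hz2⟩ := hz
  rw [tendsto_pi_nhds] at hz1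
  have hc : ∀ r, 0 < r → ∃ y, Tendsto (fun k => u (φ k) r) atTop (nhds y) := by
    intro r hr
    apply cauchySeq_tendsto_of_complete
    rw [Metric.cauchySeq_iff']
    intro ε hε
    obtain ⟨δ, hδ, hs⟩ := hequi r hr (ε / 4) (by positivity)
    obtain ⟨q, hq1, hq2⟩ := exists_rat_btwn (show r < r + δ by linarith)
    have hc := (hz1 ⟨q, hr.trans hq1⟩).cauchySeq
    rw [Metric.cauchySeq_iff'] at hc
    obtain ⟨N, hN⟩ := hc (ε / 4) (by positivity)
    refine ⟨N, fun n hn => ?_⟩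
    have h1 := hN n hn
    have h2 := hs q hq1.le hq2 (φ n)
    have h3 := hs q hq1.le hq2 (φ N)
    simp only [Function.comp, Real.dist_eq] at h1 ⊢
    rw [abs_lt] at h1 ⊢
    rw [abs_le] at h2 h3
    constructor <;> linarith [h1.1, h1.2, h2.1, h2.2, h3.1, h3.2]
  choose! v hv using hc
  exact ⟨φ, v, z.2, hφ, hv, hz2⟩

/-- Uniform decay at infinity over the unit ball. -/
theorem exists_uniform_decay {p θ : ℝ} (hp : 2 ≤ p) (hθ : 0 ≤ θ) {ε : ℝ} (hε : 0 < ε) :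
    ∃ R : ℝ, 0 < R ∧ ∀ u u' : ℝ → ℝ, MemX p (p - 1) θ u u' →
      (wInt θ fun r => |u r| ^ p) ≤ 1 → (wInt (p - 1) fun r => |u' r| ^ p) ≤ 1 →
      ∀ r, R ≤ r → |u r| ≤ ε := by
  have hp0 : 0 < p := by linarith
  set D := omegaW (p - 1) ^ (-(1 / p)) with hD
  have hη : 0 < (p - 1) / p := div_pos (by linarith) hp0
  have hωθ := omegaW_pos hθ
  have htend : Tendsto (fun δ : ℝ => D * δ ^ ((p - 1) / p)) (nhdsWithin 0 (Set.Ioi 0)) (nhds 0) := by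
    have h1 : Tendsto (fun δ : ℝ => D * δ ^ ((p - 1) / p)) (nhds 0)
        (nhds (D * (0 : ℝ) ^ ((p - 1) / p))) :=
      ((continuous_id.rpow_const fun _ => Or.inr hη.le).tendsto 0).const_mul D
    rw [Real.zero_rpow hη.ne', mul_zero] at h1
    exact h1.mono_left nhdsWithin_le_nhds
  obtain ⟨δ, hδ1, hδ0⟩ := ((htend.eventually (gt_mem_nhds (half_pos hε))).and
    self_mem_nhdsWithin).exists
  have hδ0 : 0 < δ := hδ0
  have hq : 1 < exp δ := Real.one_lt_exp_iff.2 hδ0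
  set A := (ε / 2) ^ p * (exp δ - 1) with hA
  have hA0 : 0 < A := mul_pos (by positivity) (by linarith)
  refine ⟨max 1 ((omegaW θ)⁻¹ / A + 1), by positivity, fun u u' h hu hu' r hr => ?_⟩
  have hr1 : 1 ≤ r := (le_max_left _ _).trans hr
  have hr0 : 0 < r := by linarith
  have hr2 : (omegaW θ)⁻¹ / A + 1 ≤ r := (le_max_right _ _).trans hr
  by_contra! hcon
  have hrq : r ≤ r * exp δ := le_mul_of_one_le_right hr0.le hq.le
  have hlow : ∀ s ∈ Set.Ioc r (r * exp δ), ENNReal.ofReal ((ε / 2) ^ p) ≤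
      ENNReal.ofReal (|u s| ^ p) * ENNReal.ofReal (s ^ θ) := by
    intro s hs
    have hs1 : 1 ≤ s := hr1.trans hs.1.le
    have h1 := h.abs_sub_le hp hu' hr0 hs.1.le
    have h2 : log (s / r) ≤ δ := by
      rw [Real.log_le_iff_le_exp (div_pos (by linarith) hr0), div_le_iff₀ hr0, mul_comm]
      exact hs.2
    have h3 : log (s / r) ^ ((p - 1) / p) ≤ δ ^ ((p - 1) / p) :=
      Real.rpow_le_rpow (Real.log_nonneg ((one_le_div hr0).2 hs.1.le)) h2 hη.le
    have hD0 : 0 < D := Real.rpow_pos_of_pos (omegaW_pos (by linarith)) _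
    have h4 : |u s - u r| < ε / 2 := by
      refine h1.trans_lt (lt_of_le_of_lt ?_ hδ1)
      gcongr
    have h5 : ε / 2 ≤ |u s| := by
      have := abs_sub_abs_le_abs_sub (u r) (u s)
      rw [abs_sub_comm] at this
      linarith
    rw [← ENNReal.ofReal_mul (by positivity)]
    refine ENNReal.ofReal_le_ofReal ?_
    calc (ε / 2) ^ p ≤ |u s| ^ p := by gcongr
      _ ≤ |u s| ^ p * s ^ θ := le_mul_of_one_le_right (by positivity) (Real.one_le_rpow hs1 hθ)
  have hE := lintegral_le_of_wInt_le hθ (c := 1) (hu.trans (by simp))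
  rw [mul_one] at hE
  have hsub : Set.Ioc r (r * exp δ) ⊆ Set.Ioi 0 := fun t ht => lt_trans hr0 ht.1
  have h6 : ENNReal.ofReal (A * r) ≤ ENNReal.ofReal (omegaW θ)⁻¹ := by
    calc ENNReal.ofReal (A * r)
        = ∫⁻ _ in Set.Ioc r (r * exp δ), ENNReal.ofReal ((ε / 2) ^ p) := by
          rw [setLIntegral_const, Real.volume_Ioc, ← ENNReal.ofReal_mul (by positivity), hA]
          congr 1
          ring
      _ ≤ _ := setLIntegral_mono' measurableSet_Ioc hlow
      _ ≤ _ := lintegral_mono_set hsub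
      _ ≤ _ := hE
  rw [ENNReal.ofReal_le_ofReal_iff (by positivity)] at h6
  have h7 : (omegaW θ)⁻¹ / A < r := by linarith
  rw [div_lt_iff₀ hA0] at h7
  linarith

/-- The exponential remainder `∑_{j > n} t ^ j / j!`. -/
noncomputable def expTail (n : ℕ) (t : ℝ) : ℝ :=
  exp t - ∑ j ∈ Finset.range (n + 1), t ^ j / (Nat.factorial j : ℝ)

theorem continuous_expTail (n : ℕ) : Continuous (expTail n) := by
  unfold expTail; fun_prop

theorem hasSum_pow_div_factorial (t : ℝ) :
    HasSum (fun j : ℕ => t ^ j / (Nat.factorial j : ℝ)) (exp t) := by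
  rw [Real.exp_eq_exp_ℝ]
  exact NormedSpace.expSeries_div_hasSum_exp t

theorem expTail_nonneg (n : ℕ) {t : ℝ} (ht : 0 ≤ t) : 0 ≤ expTail n t :=
  sub_nonneg.2 (Real.sum_le_exp_of_nonneg ht _)

theorem expTail_le_exp (n : ℕ) {t : ℝ} (ht : 0 ≤ t) : expTail n t ≤ exp t :=
  sub_le_self _ (Finset.sum_nonneg fun _ _ => by positivity)

theorem expTail_le (n : ℕ) {t : ℝ} (ht : 0 ≤ t) : expTail n t ≤ t ^ (n + 1) * exp t := by
  have h1 := (hasSum_nat_add_iff' (n + 1)).2 (hasSum_pow_div_factorial t)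
  have h2 := (hasSum_pow_div_factorial t).mul_left (t ^ (n + 1))
  refine hasSum_le (fun j => ?_) h1 h2
  rw [pow_add, mul_comm (t ^ j), mul_div_assoc]
  gcongr
  omega

theorem expTail_zero (n : ℕ) : expTail n 0 = 0 := by
  simp [expTail, Finset.sum_range_succ']

theorem phiP_eq {p : ℝ} {n : ℕ} (hn : (n : ℝ) = p - 1) (t : ℝ) :
    phiP p t = t ^ n / (Nat.factorial n : ℝ) + expTail n t := by
  have h1 : HasSum (fun j : ℕ => if j ∈ Finset.range n then t ^ j / (Nat.factorial j : ℝ) else 0)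
      (∑ j ∈ Finset.range n, t ^ j / (Nat.factorial j : ℝ)) := by
    have := hasSum_sum_of_ne_finset_zero (s := Finset.range n) (L := .unconditional ℕ)
      (f := fun j : ℕ => if j ∈ Finset.range n then t ^ j / (Nat.factorial j : ℝ) else 0)
      (fun j hj => if_neg hj)
    convert this using 1
    exact Finset.sum_congr rfl fun j hj => (if_pos hj).symm
  have h2 := (hasSum_pow_div_factorial t).sub h1
  have h3 : (fun j : ℕ => t ^ j / (Nat.factorial j : ℝ) -
      if j ∈ Finset.range n then t ^ j / (Nat.factorial j : ℝ) else 0) =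
      fun j : ℕ => if p - 1 ≤ (j : ℝ) then t ^ j / (Nat.factorial j : ℝ) else 0 := by
    ext j
    rw [← hn]
    simp only [Nat.cast_le, Finset.mem_range]
    split_ifs with h4 h5 h5
    · omega
    · simp
    · simp
    · omega
  rw [h3] at h2
  rw [phiP, h2.tsum_eq, expTail, Finset.sum_range_succ]
  ring

theorem wInt_const_mul {θ c : ℝ} (hc : 0 ≤ c) (f : ℝ → ℝ) :
    wInt θ (fun r => c * f r) = ENNReal.ofReal c * wInt θ f := by
  unfold wInt
  simp_rw [ENNReal.ofReal_mul hc, mul_assoc]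
  rw [lintegral_const_mul' _ _ ENNReal.ofReal_ne_top]
  ring

theorem wInt_add {θ : ℝ} {f g : ℝ → ℝ} (hf : AEMeasurable f (volume.restrict (Set.Ioi 0)))
    (hf0 : ∀ r, 0 ≤ f r) (hg0 : ∀ r, 0 ≤ g r) :
    wInt θ (fun r => f r + g r) = wInt θ f + wInt θ g := by
  unfold wInt
  simp_rw [ENNReal.ofReal_add (hf0 _) (hg0 _), add_mul]
  rw [lintegral_add_left' (by fun_prop), mul_add]

theorem mul_rpow_pow_eq {p σ x : ℝ} {n : ℕ} (hp : 2 ≤ p) (hn : (n : ℝ) = p - 1) (hσ : 0 ≤ σ)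
    (hx : 0 ≤ x) : (σ * x ^ (p / (p - 1))) ^ n = σ ^ (p - 1) * x ^ p := by
  have hp1 : p - 1 ≠ 0 := by linarith
  rw [← Real.rpow_natCast, hn, Real.mul_rpow hσ (by positivity), ← Real.rpow_mul hx,
    div_mul_cancel₀ _ hp1]

/-- Splitting off the leading term of the truncated exponential. -/
theorem TMfunc_eq {p θ σ : ℝ} {n : ℕ} (hp : 2 ≤ p) (hn : (n : ℝ) = p - 1) (hσ : 0 ≤ σ)
    {u : ℝ → ℝ} (hu : ContinuousOn u (Set.Ioi 0)) :
    TMfunc p θ σ u = ENNReal.ofReal (σ ^ (p - 1) / (Nat.factorial n : ℝ)) *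
      wInt θ (fun r => |u r| ^ p) + wInt θ (fun r => expTail n (σ * |u r| ^ (p / (p - 1)))) := by
  have hum : AEMeasurable u (volume.restrict (Set.Ioi 0)) := hu.aemeasurable measurableSet_Ioi
  rw [← wInt_const_mul (by positivity), ← wInt_add (by fun_prop) (fun r => by positivity)
    (fun r => expTail_nonneg _ (by positivity)), TMfunc]
  congr 1
  ext r
  rw [phiP_eq hn, mul_rpow_pow_eq hp hn hσ (abs_nonneg _)]
  ring

/-- Uniform pointwise bound near the origin in the subcritical regime. -/
theorem exists_exp_le_mul_rpow {p θ σ : ℝ} (hp : 2 ≤ p) (hσ : 0 < σ) (hσ' : σ < muC (p - 1) θ) :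
    ∃ C κ : ℝ, 0 ≤ C ∧ κ < θ + 1 ∧ ∀ u u' : ℝ → ℝ, MemX p (p - 1) θ u u' →
      (wInt (p - 1) fun r => |u' r| ^ p) ≤ 1 → ∀ r R : ℝ, 0 < r → r ≤ R → |u R| ≤ 1 →
      exp (σ * |u r| ^ (p / (p - 1))) ≤ C * (R / r) ^ κ := by
  have hp0 : 0 < p := by linarith
  have hp1 : 0 < p - 1 := by linarith
  have hω : 0 < omegaW (p - 1) := omegaW_pos hp1.le
  set γ := p / (p - 1) with hγ
  have hγ0 : 0 < γ := by positivity
  set D := omegaW (p - 1) ^ (-(1 / p)) with hD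
  have hD0 : 0 < D := by positivity
  have hDγ : σ * D ^ γ < θ + 1 := by
    have h1 : D ^ γ = (omegaW (p - 1) ^ (1 / (p - 1)))⁻¹ := by
      rw [hD, ← Real.rpow_mul hω.le, ← Real.rpow_neg hω.le]
      congr 1
      rw [hγ]
      field_simp
    rw [h1, ← div_eq_mul_inv, div_lt_iff₀ (by positivity)]
    exact hσ'
  have htend : Tendsto (fun ε : ℝ => σ * ((1 + ε) * D) ^ γ) (nhdsWithin 0 (Set.Ioi 0))
      (nhds (σ * D ^ γ)) := by
    have h1 : Continuous fun ε : ℝ => σ * ((1 + ε) * D) ^ γ :=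
      continuous_const.mul ((by fun_prop : Continuous fun ε : ℝ => (1 + ε) * D).rpow_const
        fun _ => Or.inr hγ0.le)
    have h2 := h1.tendsto 0
    simp only [add_zero, one_mul] at h2
    exact h2.mono_left nhdsWithin_le_nhds
  obtain ⟨ε, hε1, hε0⟩ := ((htend.eventually (gt_mem_nhds hDγ)).and self_mem_nhdsWithin).exists
  have hε0 : 0 < ε := hε0
  refine ⟨exp (σ * (1 + 1 / ε) ^ γ), σ * ((1 + ε) * D) ^ γ, (exp_pos _).le, hε1,
    fun u u' h hu' r R hr hrR huR => ?_⟩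
  set L := log (R / r) with hL
  have hL0 : 0 ≤ L := Real.log_nonneg ((one_le_div hr).2 hrR)
  have hLγ : (L ^ ((p - 1) / p)) ^ γ = L := by
    rw [← Real.rpow_mul hL0, hγ, div_mul_div_cancel₀ hp0.ne', div_self hp1.ne', Real.rpow_one]
  have h1 := h.abs_sub_le hp hu' hr hrR
  have h2 : |u r| ≤ 1 + D * L ^ ((p - 1) / p) := by
    have := abs_sub_abs_le_abs_sub (u r) (u R)
    rw [abs_sub_comm] at this
    linarith
  have h3 : |u r| ^ γ ≤ (1 + 1 / ε) ^ γ + ((1 + ε) * D) ^ γ * L := by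
    set y := D * L ^ ((p - 1) / p) with hy
    have hy0 : 0 ≤ y := by positivity
    rcases le_total 1 (ε * y) with h4 | h4
    · have : |u r| ≤ ((1 + ε) * D) * L ^ ((p - 1) / p) := by
        rw [mul_assoc, ← hy]; linarith
      calc |u r| ^ γ ≤ (((1 + ε) * D) * L ^ ((p - 1) / p)) ^ γ := by gcongr
        _ = ((1 + ε) * D) ^ γ * L := by rw [Real.mul_rpow (by positivity) (by positivity), hLγ]
        _ ≤ _ := le_add_of_nonneg_left (by positivity)
    · have : y ≤ 1 / ε := by rw [le_div_iff₀ hε0]; linarith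
      calc |u r| ^ γ ≤ (1 + 1 / ε) ^ γ := by gcongr; linarith
        _ ≤ _ := le_add_of_nonneg_right (by positivity)
  have hRr : 0 < R / r := div_pos (hr.trans_le hrR) hr
  rw [Real.rpow_def_of_pos hRr, ← Real.exp_add, ← hL]
  refine Real.exp_le_exp.2 ?_
  calc σ * |u r| ^ γ ≤ σ * ((1 + 1 / ε) ^ γ + ((1 + ε) * D) ^ γ * L) := by gcongr
    _ = _ := by ring

/-- Upper semicontinuity of the higher-order part along pointwise convergent sequences in the
unit ball. -/
theorem limsup_wInt_expTail_le {p θ σ : ℝ} {n : ℕ} (hp : 2 ≤ p) (hθ : 0 ≤ θ)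
    (hn : (n : ℝ) = p - 1) (hσ : 0 < σ) (hσ' : σ < muC (p - 1) θ)
    {u u' : ℕ → ℝ → ℝ} {v : ℝ → ℝ} (h : ∀ k, MemX p (p - 1) θ (u k) (u' k))
    (hu : ∀ k, (wInt θ fun r => |u k r| ^ p) ≤ 1)
    (hu' : ∀ k, (wInt (p - 1) fun r => |u' k r| ^ p) ≤ 1)
    (hv : ∀ r, 0 < r → Tendsto (fun k => u k r) atTop (nhds (v r))) :
    limsup (fun k => wInt θ fun r => expTail n (σ * |u k r| ^ (p / (p - 1)))) atTop ≤
      wInt θ fun r => expTail n (σ * |v r| ^ (p / (p - 1))) := by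
  have hp0 : 0 < p := by linarith
  have hp1 : 0 < p - 1 := by linarith
  set γ := p / (p - 1) with hγ
  have hγ0 : 0 < γ := by positivity
  have hγ1 : 1 ≤ γ := by rw [hγ, one_le_div hp1]; linarith
  refine ENNReal.le_of_forall_pos_le_add fun ε hε _ => ?_
  set B := σ ^ (n + 1) * exp σ with hB
  have hB0 : 0 < B := by positivity
  set η : ℝ := min 1 (ε / B) with hη
  have hε' : (0 : ℝ) < ε := hε
  have hη0 : 0 < η := lt_min one_pos (div_pos hε' hB0)
  have hη1 : η ≤ 1 := min_le_left _ _
  have hBη : B * η ≤ ε := by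
    rw [mul_comm, ← le_div_iff₀ hB0]; exact min_le_right _ _
  obtain ⟨R, hR, hdecay⟩ := exists_uniform_decay hp hθ hη0
  obtain ⟨C, κ, hC, hκ, hdom⟩ := exists_exp_le_mul_rpow hp hσ hσ'
  set F : ℕ → ℝ → ℝ≥0∞ := fun k r => ENNReal.ofReal (expTail n (σ * |u k r| ^ γ)) *
    ENNReal.ofReal (r ^ θ) with hF
  set G : ℝ → ℝ≥0∞ := fun r => ENNReal.ofReal (expTail n (σ * |v r| ^ γ)) *
    ENNReal.ofReal (r ^ θ) with hG
  have hsub : Set.Ioc 0 R ⊆ Set.Ioi 0 := fun t ht => ht.1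
  have hlim : Tendsto (fun k => ∫⁻ r in Set.Ioc 0 R, F k r) atTop
      (nhds (∫⁻ r in Set.Ioc 0 R, G r)) := by
    refine tendsto_lintegral_of_dominated_convergence'
      (fun r => ENNReal.ofReal (C * R ^ κ * r ^ (θ - κ))) (fun k => ?_) (fun k => ?_) ?_ ?_
    · have h1 : AEMeasurable (u k) (volume.restrict (Set.Ioc 0 R)) :=
        ((h k).continuousOn.mono hsub).aemeasurable measurableSet_Ioc
      have := (continuous_expTail n).measurable
      fun_prop
    · filter_upwards [ae_restrict_mem measurableSet_Ioc] with r hr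
      have hr0 : 0 < r := hr.1
      simp only [hF]
      rw [← ENNReal.ofReal_mul (expTail_nonneg _ (by positivity))]
      refine ENNReal.ofReal_le_ofReal ?_
      calc expTail n (σ * |u k r| ^ γ) * r ^ θ ≤ C * (R / r) ^ κ * r ^ θ := by
            gcongr
            exact (expTail_le_exp _ (by positivity)).trans (hdom _ _ (h k) (hu' k) r R hr0 hr.2
              ((hdecay _ _ (h k) (hu k) (hu' k) R le_rfl).trans hη1))
        _ = _ := by
            rw [Real.div_rpow hR.le hr0.le, Real.rpow_sub hr0]
            field_simp
    · have h1 : IntegrableOn (fun r : ℝ => C * R ^ κ * r ^ (θ - κ)) (Set.Ioc 0 R) := by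
        rw [← intervalIntegrable_iff_integrableOn_Ioc_of_le hR.le]
        exact (intervalIntegral.intervalIntegrable_rpow' (by linarith)).const_mul _
      exact (h1.lintegral_lt_top).ne
    · filter_upwards [ae_restrict_mem measurableSet_Ioc] with r hr
      have h1 : Continuous fun x : ℝ => expTail n (σ * |x| ^ γ) :=
        (continuous_expTail n).comp (continuous_const.mul
          (continuous_abs.rpow_const fun _ => Or.inr hγ0.le))
      exact ENNReal.Tendsto.mul_const (ENNReal.tendsto_ofReal
        ((h1.tendsto (v r)).comp (hv r hr.1))) (Or.inr ENNReal.ofReal_ne_top)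
  have hlim2 : Tendsto (fun k => ENNReal.ofReal (omegaW θ) * (∫⁻ r in Set.Ioc 0 R, F k r) + ε)
      atTop (nhds (ENNReal.ofReal (omegaW θ) * (∫⁻ r in Set.Ioc 0 R, G r) + ε)) :=
    (ENNReal.Tendsto.const_mul hlim (Or.inr ENNReal.ofReal_ne_top)).add_const _
  have hbound : ∀ k, (wInt θ fun r => expTail n (σ * |u k r| ^ γ)) ≤
      ENNReal.ofReal (omegaW θ) * (∫⁻ r in Set.Ioc 0 R, F k r) + ε := by
    intro k
    have hsplit : ∫⁻ r in Set.Ioi 0, F k r =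
        (∫⁻ r in Set.Ioc 0 R, F k r) + ∫⁻ r in Set.Ioi R, F k r := by
      rw [← Set.Ioc_union_Ioi_eq_Ioi hR.le, lintegral_union measurableSet_Ioi]
      exact Set.Ioc_disjoint_Ioi le_rfl
    have htail : ENNReal.ofReal (omegaW θ) * (∫⁻ r in Set.Ioi R, F k r) ≤ ε := by
      calc ENNReal.ofReal (omegaW θ) * (∫⁻ r in Set.Ioi R, F k r)
          ≤ ENNReal.ofReal (omegaW θ) * (∫⁻ r in Set.Ioi R,
              ENNReal.ofReal (ε * |u k r| ^ p) * ENNReal.ofReal (r ^ θ)) := by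
            refine mul_le_mul_right ?_ _
            refine setLIntegral_mono' measurableSet_Ioi fun r hr => ?_
            simp only [hF]
            gcongr
            have h1 : |u k r| ≤ η := hdecay _ _ (h k) (hu k) (hu' k) r (le_of_lt hr)
            have h2 : |u k r| ^ γ ≤ η := by
              calc |u k r| ^ γ ≤ η ^ γ := by gcongr
                _ ≤ η ^ (1 : ℝ) := Real.rpow_le_rpow_of_exponent_ge hη0 hη1 hγ1
                _ = η := Real.rpow_one _
            have h3 : σ * |u k r| ^ γ ≤ σ :=
              mul_le_of_le_one_right hσ.le (h2.trans hη1)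
            calc expTail n (σ * |u k r| ^ γ)
                ≤ (σ * |u k r| ^ γ) ^ (n + 1) * exp (σ * |u k r| ^ γ) :=
                  expTail_le _ (by positivity)
              _ ≤ (σ * |u k r| ^ γ) ^ (n + 1) * exp σ := by gcongr
              _ = σ ^ (n + 1) * exp σ * |u k r| ^ γ * |u k r| ^ p := by
                  rw [pow_succ, mul_rpow_pow_eq hp hn hσ.le (abs_nonneg _), pow_succ,
                    ← Real.rpow_natCast σ n, hn]
                  ring
              _ ≤ σ ^ (n + 1) * exp σ * η * |u k r| ^ p := by gcongr
              _ ≤ ε * |u k r| ^ p := by gcongr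
        _ ≤ wInt θ (fun r => ε * |u k r| ^ p) := by
            rw [wInt]
            gcongr
        _ = ENNReal.ofReal ε * wInt θ (fun r => |u k r| ^ p) := wInt_const_mul hε'.le _
        _ ≤ ENNReal.ofReal ε * 1 := by gcongr; exact hu k
        _ = ε := by simp
    rw [wInt, hsplit, mul_add]
    gcongr
  calc _ ≤ limsup (fun k => ENNReal.ofReal (omegaW θ) * (∫⁻ r in Set.Ioc 0 R, F k r) + ε) atTop :=
        limsup_le_limsup (Eventually.of_forall hbound)
    _ = _ := hlim2.limsup_eq
    _ ≤ _ := by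
        rw [wInt]
        gcongr

theorem wInt_comp_mul_left {θ s : ℝ} (hs : 0 < s) (f : ℝ → ℝ) :
    wInt θ (fun r => f (s * r)) = ENNReal.ofReal (s ^ (-(θ + 1))) * wInt θ f := by
  have himg : (fun r => s⁻¹ * r) '' Set.Ioi (0 : ℝ) = Set.Ioi 0 := by
    rw [Set.image_mul_left_Ioi (inv_pos.2 hs), mul_zero]
  have key := lintegral_image_eq_lintegral_abs_deriv_mul (f := fun r => s⁻¹ * r)
    (f' := fun _ => s⁻¹) (measurableSet_Ioi (a := (0 : ℝ)))
    (fun x _ => by simpa using ((hasDerivAt_id x).const_mul s⁻¹).hasDerivWithinAt)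
    (mul_right_injective₀ (inv_pos.2 hs).ne').injOn
    (fun r => ENNReal.ofReal (f (s * r)) * ENNReal.ofReal (r ^ θ))
  rw [himg] at key
  rw [wInt, wInt, key, mul_left_comm, 
    ← lintegral_const_mul' (ENNReal.ofReal (s ^ (-(θ + 1)))) _ ENNReal.ofReal_ne_top]
  congr 1
  refine setLIntegral_congr_fun measurableSet_Ioi fun r hr => ?_
  have hr0 : 0 < r := hr
  have h1 : s⁻¹ * (s⁻¹ * r) ^ θ = s ^ (-(θ + 1)) * r ^ θ := by
    rw [Real.mul_rpow (by positivity) hr0.le, Real.inv_rpow hs.le, neg_add, Real.rpow_add hs,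
      Real.rpow_neg_one, Real.rpow_neg hs.le]
    ring
  rw [mul_inv_cancel_left₀ hs.ne', abs_of_pos (inv_pos.2 hs),
    mul_left_comm (ENNReal.ofReal s⁻¹), mul_left_comm (ENNReal.ofReal (s ^ (-(θ + 1)))),
    ← ENNReal.ofReal_mul (p := s⁻¹) (by positivity),
    ← ENNReal.ofReal_mul (p := s ^ (-(θ + 1))) (by positivity), h1]

theorem wInt_deriv_comp_mul_left {p s : ℝ} (hs : 0 < s) (f : ℝ → ℝ) :
    (wInt (p - 1) fun r => |s * f (s * r)| ^ p) = wInt (p - 1) fun r => |f r| ^ p := by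
  have h1 : (fun r => |s * f (s * r)| ^ p) = fun r => (fun t => s ^ p * |f t| ^ p) (s * r) := by
    ext r
    rw [abs_mul, abs_of_pos hs, Real.mul_rpow hs.le (abs_nonneg _)]
  rw [h1, wInt_comp_mul_left hs (fun t => s ^ p * |f t| ^ p), wInt_const_mul (by positivity), ← mul_assoc,
    ← ENNReal.ofReal_mul (by positivity), ← Real.rpow_add hs]
  simp

theorem memX_iff_wInt_lt_top {p α θ : ℝ} (hp : 0 < p) {u u' : ℝ → ℝ}
    (h1 : ∀ a b : ℝ, 0 < a → a ≤ b → IntervalIntegrable u' volume a b)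
    (h2 : ∀ a b : ℝ, 0 < a → a ≤ b → u b - u a = ∫ t in a..b, u' t)
    (h3 : Tendsto u atTop (nhds 0)) :
    MemX p α θ u u' ↔ (wInt θ fun r => |u r| ^ p) < ⊤ ∧ (wInt α fun r => |u' r| ^ p) < ⊤ := by
  rw [← wNorm_lt_top_iff hp, ← wNorm_lt_top_iff hp]
  exact ⟨fun h => ⟨h.fin_u, h.fin_u'⟩, fun h => ⟨h1, h2, h3, h.1, h.2⟩⟩

theorem MemX.comp_mul_left {p θ s : ℝ} (hp : 0 < p) (hs : 0 < s) {u u' : ℝ → ℝ}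
    (h : MemX p (p - 1) θ u u') :
    MemX p (p - 1) θ (fun r => u (s * r)) (fun r => s * u' (s * r)) := by
  refine (memX_iff_wInt_lt_top hp (fun a b ha hab => ?_) (fun a b ha hab => ?_) ?_).2 ⟨?_, ?_⟩
  · have h1 := (h.ftc_int (s * a) (s * b) (by positivity) (by gcongr)).comp_mul_left (c := s)
    rw [mul_div_cancel_left₀ _ hs.ne', mul_div_cancel_left₀ _ hs.ne'] at h1
    exact h1.const_mul s
  · rw [h.ftc (s * a) (s * b) (by positivity) (by gcongr), intervalIntegral.integral_const_mul,
      intervalIntegral.mul_integral_comp_mul_left]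
  · exact h.lim_zero.comp (tendsto_id.const_mul_atTop hs)
  · rw [wInt_comp_mul_left hs (fun r => |u r| ^ p)]
    exact ENNReal.mul_lt_top ENNReal.ofReal_lt_top ((wNorm_lt_top_iff hp u).1 h.fin_u)
  · rw [wInt_deriv_comp_mul_left hs]
    exact (wNorm_lt_top_iff hp u').1 h.fin_u'

theorem wInt_abs_rpow_le_liminf {p θ : ℝ} (hp : 0 < p) {u : ℕ → ℝ → ℝ} {v : ℝ → ℝ}
    (hu : ∀ k, ContinuousOn (u k) (Set.Ioi 0))
    (hv : ∀ r, 0 < r → Tendsto (fun k => u k r) atTop (nhds (v r))) :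
    (wInt θ fun r => |v r| ^ p) ≤ liminf (fun k => wInt θ fun r => |u k r| ^ p) atTop := by
  have h1 : ∫⁻ r in Set.Ioi (0 : ℝ), ENNReal.ofReal (|v r| ^ p) * ENNReal.ofReal (r ^ θ) ≤
      liminf (fun k => ∫⁻ r in Set.Ioi (0 : ℝ),
        ENNReal.ofReal (|u k r| ^ p) * ENNReal.ofReal (r ^ θ)) atTop := by
    refine le_trans (le_of_eq ?_) (lintegral_liminf_le' fun k => ?_)
    · refine setLIntegral_congr_fun measurableSet_Ioi fun r hr => ?_
      refine (Tendsto.liminf_eq (ENNReal.Tendsto.mul_const (ENNReal.tendsto_ofReal ?_)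
        (Or.inr ENNReal.ofReal_ne_top))).symm
      exact (hv r hr).abs.rpow_const (Or.inr hp.le)
    · have := (hu k).aemeasurable (μ := volume) measurableSet_Ioi
      fun_prop
  calc _ ≤ liminf (fun _ : ℕ => ENNReal.ofReal (omegaW θ)) atTop *
        liminf (fun k => ∫⁻ r in Set.Ioi (0 : ℝ),
          ENNReal.ofReal (|u k r| ^ p) * ENNReal.ofReal (r ^ θ)) atTop := by
        rw [liminf_const, wInt]
        exact mul_le_mul_right h1 _
    _ ≤ _ := ENNReal.le_liminf_mul

theorem wInt_deriv_rpow_le_liminf {p θ : ℝ} {u u' : ℕ → ℝ → ℝ} {v : ℝ → ℝ}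
    (hp : 2 ≤ p) (h : ∀ k, MemX p (p - 1) θ (u k) (u' k))
    (hv : ∀ r, 0 < r → Tendsto (fun k => u k r) atTop (nhds (v r)))
    (hvc : ContinuousOn v (Set.Ioi 0))
    (hvd : ∀ᵐ r ∂volume.restrict (Set.Ioi 0), DifferentiableAt ℝ v r) :
    (wInt (p - 1) fun r => |deriv v r| ^ p) ≤
      liminf (fun k => wInt (p - 1) fun r => |u' k r| ^ p) atTop := by
  calc _ ≤ liminf (fun _ : ℕ => ENNReal.ofReal (omegaW (p - 1))) atTop *
        liminf (fun k => ∫⁻ r in Set.Ioi (0 : ℝ),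
          ENNReal.ofReal (|u' k r| ^ p) * ENNReal.ofReal (r ^ (p - 1))) atTop := by
        rw [liminf_const, wInt]
        exact mul_le_mul_right (lintegral_deriv_rpow_le_liminf hp h hv hvc hvd) _
    _ ≤ _ := ENNReal.le_liminf_mul

/-- Sequential compactness of the unit ball of `X` for pointwise convergence, keeping track of
the limit mass. -/
theorem exists_subseq_tendsto_memX {p θ : ℝ} (hp : 2 ≤ p) (hθ : 0 ≤ θ)
    {u u' : ℕ → ℝ → ℝ} (h : ∀ k, MemX p (p - 1) θ (u k) (u' k))
    (hX : ∀ k, (wInt θ fun r => |u k r| ^ p) + (wInt (p - 1) fun r => |u' k r| ^ p) ≤ 1) :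
    ∃ (φ : ℕ → ℕ) (v : ℝ → ℝ) (L : ℝ≥0∞), StrictMono φ ∧
      (∀ r, 0 < r → Tendsto (fun k => u (φ k) r) atTop (nhds (v r))) ∧
      Tendsto (fun k => wInt θ fun r => |u (φ k) r| ^ p) atTop (nhds L) ∧
      MemX p (p - 1) θ v (deriv v) ∧ (wInt θ fun r => |v r| ^ p) ≤ L ∧
      L + (wInt (p - 1) fun r => |deriv v r| ^ p) ≤ 1 := by
  have hp0 : 0 < p := by linarith
  have hη : 0 < (p - 1) / p := div_pos (by linarith) hp0
  have hu : ∀ k, (wInt θ fun r => |u k r| ^ p) ≤ 1 := fun k => le_self_add.trans (hX k)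
  have hu' : ∀ k, (wInt (p - 1) fun r => |u' k r| ^ p) ≤ 1 := fun k => le_add_self.trans (hX k)
  set D := omegaW (p - 1) ^ (-(1 / p)) with hD
  have hbdd : ∀ r, 0 < r → ∃ M, ∀ k, |u k r| ≤ M := by
    intro r hr
    obtain ⟨R, hR, hdecay⟩ := exists_uniform_decay hp hθ one_pos
    refine ⟨1 + D * log (max r R / r) ^ ((p - 1) / p), fun k => ?_⟩
    have h1 := (h k).abs_sub_le hp (hu' k) hr (le_max_left r R)
    have h2 := hdecay _ _ (h k) (hu k) (hu' k) (max r R) (le_max_right r R)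
    have h3 := abs_sub_abs_le_abs_sub (u k r) (u k (max r R))
    rw [abs_sub_comm] at h3
    linarith
  have hequi : ∀ r, 0 < r → ∀ ε > 0, ∃ δ > 0, ∀ s, r ≤ s → s < r + δ →
      ∀ k, |u k s - u k r| ≤ ε := by
    intro r hr ε hε
    have h1 : ContinuousAt (fun s : ℝ => D * log (s / r) ^ ((p - 1) / p)) r := by
      refine ContinuousAt.mul continuousAt_const (ContinuousAt.rpow_const
        (ContinuousAt.log (by fun_prop) ?_) (Or.inr hη.le))
      rw [div_self hr.ne']
      exact one_ne_zero
    have h2 : (fun s : ℝ => D * log (s / r) ^ ((p - 1) / p)) r < ε := by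
      simp only [div_self hr.ne', Real.log_one, Real.zero_rpow hη.ne', mul_zero]
      exact hε
    obtain ⟨δ, hδ, hs⟩ := Metric.eventually_nhds_iff.1 (h1.eventually (gt_mem_nhds h2))
    refine ⟨δ, hδ, fun s hrs hsδ k => ((h k).abs_sub_le hp (hu' k) hr hrs).trans (hs ?_).le⟩
    rw [Real.dist_eq, abs_of_nonneg (by linarith)]
    linarith
  obtain ⟨φ, v, L, hφ, hv, hL⟩ := exists_subseq_tendsto_pointwise
    (a := fun k => wInt θ fun r => |u k r| ^ p) hbdd hequi
  have hL1 : L ≤ 1 := le_of_tendsto' hL fun k => hu _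
  have hac : ∀ a b : ℝ, 0 < a → a ≤ b → AbsolutelyContinuousOnInterval v a b := fun a b ha hab =>
    absolutelyContinuousOnInterval_of_tendsto hp (fun k => h (φ k)) (fun k => hu' _) hv ha hab
  have hvc : ContinuousOn v (Set.Ioi 0) := continuousOn_Ioi_of_continuousOn_Icc fun a b ha hab => by
    have := (hac a b ha hab).continuousOn
    rwa [Set.uIcc_of_le hab] at this
  have hvd : ∀ᵐ r ∂volume.restrict (Set.Ioi 0), DifferentiableAt ℝ v r := by
    rw [ae_restrict_iff' measurableSet_Ioi]
    have hle : ∀ n : ℕ, (1 : ℝ) / ((n : ℝ) + 1) ≤ (n : ℝ) + 1 := fun n => by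
      rw [div_le_iff₀ (by positivity)]
      nlinarith [(Nat.cast_nonneg n : (0 : ℝ) ≤ n)]
    have h1 := ae_all_iff.2 fun n : ℕ =>
      (hac (1 / ((n : ℝ) + 1)) ((n : ℝ) + 1) (by positivity) (hle n)).ae_differentiableAt
    filter_upwards [h1] with x hx hx0
    obtain ⟨n, hn⟩ := exists_nat_one_div_lt (Set.mem_Ioi.1 hx0)
    obtain ⟨m, hm⟩ := exists_nat_ge x
    refine hx (max n m) ?_
    rw [Set.uIcc_of_le (hle _)]
    refine ⟨le_trans ?_ hn.le, hm.trans ?_⟩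
    · gcongr; exact le_max_left _ _
    · have : (m : ℝ) ≤ (max n m : ℕ) := by exact_mod_cast le_max_right _ _
      linarith
  have hlim0 : Tendsto v atTop (nhds 0) := by
    rw [Metric.tendsto_atTop]
    intro ε hε
    obtain ⟨R, hR, hdecay⟩ := exists_uniform_decay hp hθ (half_pos hε)
    refine ⟨R, fun r hr => ?_⟩
    have h1 : |v r| ≤ ε / 2 := le_of_tendsto' (hv r (hR.trans_le hr)).abs fun k =>
      hdecay _ _ (h _) (hu _) (hu' _) r hr
    rw [Real.dist_eq, sub_zero]
    linarith
  have hmass : (wInt θ fun r => |v r| ^ p) ≤ L :=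
    (wInt_abs_rpow_le_liminf hp0 (fun k => (h (φ k)).continuousOn) hv).trans_eq hL.liminf_eq
  have hgrad : (wInt (p - 1) fun r => |deriv v r| ^ p) ≤ 1 - L := by
    refine (wInt_deriv_rpow_le_liminf hp (fun k => h (φ k)) hv hvc hvd).trans ?_
    have h1 : Tendsto (fun k => 1 - wInt θ fun r => |u (φ k) r| ^ p) atTop (nhds (1 - L)) :=
      ENNReal.Tendsto.sub tendsto_const_nhds hL (Or.inl ENNReal.one_ne_top)
    rw [← h1.liminf_eq]
    refine liminf_le_liminf (Eventually.of_forall fun k => ?_)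
    exact ENNReal.le_sub_of_add_le_left ((hu _).trans_lt ENNReal.one_lt_top).ne (hX _)
  refine ⟨φ, v, L, hφ, hv, hL, ?_, hmass, ?_⟩
  · refine (memX_iff_wInt_lt_top hp0 (fun a b ha hab => (hac a b ha hab).intervalIntegrable_deriv)
      (fun a b ha hab => (hac a b ha hab).integral_deriv_eq_sub.symm) hlim0).2 ⟨?_, ?_⟩
    · exact (hmass.trans hL1).trans_lt ENNReal.one_lt_top
    · exact (hgrad.trans tsub_le_self).trans_lt ENNReal.one_lt_top
  · calc L + _ ≤ L + (1 - L) := by gcongr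
      _ = 1 := add_tsub_cancel_of_le hL1

theorem wInt_expTail_eq_zero {p θ σ : ℝ} {n : ℕ} (hp : 2 ≤ p) {v : ℝ → ℝ}
    (hv : ContinuousOn v (Set.Ioi 0)) (h0 : (wInt θ fun r => |v r| ^ p) = 0) (hθ : 0 ≤ θ) :
    (wInt θ fun r => expTail n (σ * |v r| ^ (p / (p - 1)))) = 0 := by
  have hp0 : 0 < p := by linarith
  have hvm := hv.aemeasurable (μ := volume) measurableSet_Ioi
  have hγ : p / (p - 1) ≠ 0 := (div_pos hp0 (by linarith)).ne'
  rw [wInt, mul_eq_zero, ENNReal.ofReal_eq_zero, or_iff_right (omegaW_pos hθ).not_ge,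
    lintegral_eq_zero_iff' (by fun_prop)] at h0
  rw [wInt, mul_eq_zero]
  right
  rw [← lintegral_zero (μ := volume.restrict (Set.Ioi (0 : ℝ)))]
  refine lintegral_congr_ae ?_
  filter_upwards [h0, ae_restrict_mem measurableSet_Ioi] with r hr hr0
  have hr0 : 0 < r := hr0
  have h2 : v r = 0 := by
    by_contra hne
    have : 0 < |v r| := abs_pos.2 hne
    simp only [Pi.zero_apply, mul_eq_zero, ENNReal.ofReal_eq_zero] at hr
    rcases hr with hr | hr
    · exact absurd hr (by positivity : 0 < |v r| ^ p).not_ge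
    · exact absurd hr (by positivity : 0 < r ^ θ).not_ge
  rw [h2, abs_zero, Real.zero_rpow hγ, mul_zero, expTail_zero]
  simp

theorem memX_zero {p α θ : ℝ} (hp : 0 < p) : MemX p α θ (fun _ => 0) (fun _ => 0) := by
  have h1 : ∀ β : ℝ, (wInt β fun _ => |(0 : ℝ)| ^ p) = 0 := fun β => by
    simp [wInt, Real.zero_rpow hp.ne']
  refine (memX_iff_wInt_lt_top hp (fun a b _ _ => intervalIntegrable_const) (by simp)
    tendsto_const_nhds).2 ⟨?_, ?_⟩ <;> rw [h1] <;> exact ENNReal.zero_lt_top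

theorem exists_maximizing_seq {p α θ σ : ℝ} (hp : 0 < p) :
    ∃ u u' : ℕ → ℝ → ℝ, (∀ k, MemX p α θ (u k) (u' k)) ∧ (∀ k, Xnorm p α θ (u k) (u' k) ≤ 1) ∧
      Tendsto (fun k => TMfunc p θ σ (u k)) atTop (nhds (TMC p α θ σ)) := by
  set S : Set ℝ≥0∞ := {x | ∃ u u', MemX p α θ u u' ∧ Xnorm p α θ u u' ≤ 1 ∧ TMfunc p θ σ u = x}
    with hS
  have hne : S.Nonempty := by
    refine ⟨_, fun _ => 0, fun _ => 0, memX_zero hp, ?_, rfl⟩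
    rw [Xnorm_le_one_iff hp]
    simp [wInt, Real.zero_rpow hp.ne']
  have hsup : TMC p α θ σ = sSup S := by
    refine le_antisymm ?_ ?_
    · exact iSup_le fun u => iSup_le fun u' => iSup_le fun h => iSup_le fun h1 =>
        le_sSup ⟨u, u', h, h1, rfl⟩
    · refine sSup_le ?_
      rintro _ ⟨u, u', h, h1, rfl⟩
      exact le_iSup₂_of_le u u' (le_iSup₂_of_le h h1 le_rfl)
  obtain ⟨x, -, hx, hxS⟩ := exists_seq_tendsto_sSup hne (OrderTop.bddAbove S)
  choose u u' h h1 h2 using hxS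
  refine ⟨u, u', h, h1, ?_⟩
  rw [hsup]
  simpa only [h2] using hx

theorem limsup_add_le_of_tendsto {f : ℕ → ℝ≥0∞} {A : ℝ≥0∞}
    (hf : Tendsto f atTop (nhds A)) (g : ℕ → ℝ≥0∞) :
    limsup (fun k => f k + g k) atTop ≤ A + limsup g atTop := by
  refine ENNReal.le_of_forall_pos_le_add fun ε hε hfin => ?_
  have hA : A < A + ε := ENNReal.lt_add_right (ENNReal.add_lt_top.1 hfin).1.ne (by simpa using hε.ne')
  calc limsup (fun k => f k + g k) atTop ≤ limsup (fun k => (A + ε) + g k) atTop := by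
        refine limsup_le_limsup ?_
        filter_upwards [hf.eventually (gt_mem_nhds hA)] with k hk
        gcongr
    _ = (A + ε) + limsup g atTop :=
        limsup_const_add atTop g _ (by isBoundedDefault) (by isBoundedDefault)
    _ = A + limsup g atTop + ε := add_right_comm _ _ _

theorem stmt_8 (p α θ σ : ℝ) (hp : 2 ≤ p) (hα : α = p - 1) (hθ : 0 ≤ θ)
    (hk : (k0 p : ℝ) = p - 1) (hσ : 0 < σ) (hσ' : σ < muC α θ)
    (hbig : ENNReal.ofReal (σ ^ (p - 1) / (Nat.factorial (k0 p) : ℝ)) < TMC p α θ σ) :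
    TMCAttained p α θ σ := by
  subst hα
  have hp0 : 0 < p := by linarith
  obtain ⟨u, u', h, hX, htend⟩ := exists_maximizing_seq (p := p) (α := p - 1) (θ := θ) (σ := σ) hp0
  simp only [Xnorm_le_one_iff hp0] at hX
  obtain ⟨φ, v, L, hφ, hv, hL, hvX, hmass, hsum⟩ := exists_subseq_tendsto_memX hp hθ h hX
  set c := ENNReal.ofReal (σ ^ (p - 1) / (Nat.factorial (k0 p) : ℝ)) with hc
  set E := wInt θ fun r => expTail (k0 p) (σ * |v r| ^ (p / (p - 1))) with hE
  have hL1 : L ≤ 1 := le_self_add.trans hsum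
  have hupper : TMC p (p - 1) θ σ ≤ c * L + E := by
    rw [← (htend.comp hφ.tendsto_atTop).limsup_eq]
    have h1 : (fun k => TMfunc p θ σ (u k)) ∘ φ = fun k => (c * wInt θ fun r => |u (φ k) r| ^ p) +
        wInt θ fun r => expTail (k0 p) (σ * |u (φ k) r| ^ (p / (p - 1))) := by
      ext k
      exact TMfunc_eq hp hk hσ.le (h (φ k)).continuousOn
    rw [h1]
    refine (limsup_add_le_of_tendsto
      (ENNReal.Tendsto.const_mul hL (Or.inr ENNReal.ofReal_ne_top)) _).trans ?_
    gcongr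
    exact limsup_wInt_expTail_le hp hθ hk hσ hσ' (fun k => h (φ k))
      (fun k => le_self_add.trans (hX _)) (fun k => le_add_self.trans (hX _)) hv
  set a := wInt θ fun r => |v r| ^ p with ha
  have ha0 : a ≠ 0 := by
    intro h0
    rw [hE, wInt_expTail_eq_zero hp hvX.continuousOn h0 hθ, add_zero] at hupper
    exact absurd (hupper.trans (mul_le_of_le_one_right' hL1)) hbig.not_ge
  have hLtop : L ≠ ⊤ := (hL1.trans_lt ENNReal.one_lt_top).ne
  have hatop : a ≠ ⊤ := (hmass.trans_lt hLtop.lt_top).ne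
  have hq : L / a ≠ ⊤ := ENNReal.div_ne_top hLtop ha0
  have hq1 : 1 ≤ L / a := by
    rwa [ENNReal.le_div_iff_mul_le (Or.inl ha0) (Or.inl hatop), one_mul]
  set t := (L / a).toReal with ht
  have ht0 : 0 < t := ENNReal.toReal_pos (one_pos.trans_le hq1).ne' hq
  set s := t ^ (-(1 / (θ + 1))) with hs
  have hs0 : 0 < s := by positivity
  have hst : ENNReal.ofReal (s ^ (-(θ + 1))) = L / a := by
    rw [hs, ← Real.rpow_mul ht0.le, neg_mul_neg, one_div_mul_cancel (by linarith), Real.rpow_one,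
      ht, ENNReal.ofReal_toReal hq]
  have hwX := hvX.comp_mul_left hp0 hs0
  have hwmass : (wInt θ fun r => |v (s * r)| ^ p) = L := by
    rw [wInt_comp_mul_left hs0 (fun r => |v r| ^ p), hst, ENNReal.div_mul_cancel ha0 hatop]
  have hwnorm : Xnorm p (p - 1) θ (fun r => v (s * r)) (fun r => s * deriv v (s * r)) ≤ 1 := by
    rw [Xnorm_le_one_iff hp0, hwmass, wInt_deriv_comp_mul_left hs0]
    exact hsum
  refine ⟨_, _, hwX, hwnorm, le_antisymm ?_ ?_⟩
  · rw [TMfunc_eq hp hk hσ.le hwX.continuousOn, hwmass,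
      wInt_comp_mul_left hs0 (fun r => expTail (k0 p) (σ * |v r| ^ (p / (p - 1)))), hst]
    refine hupper.trans ?_
    gcongr
    exact le_mul_of_one_le_left' hq1
  · exact le_iSup₂_of_le _ _ (le_iSup₂_of_le hwX hwnorm le_rfl)
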